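/- Let q ∈ ℕ with q ≥ 2 and set t₁(q) = 1/(1+q), t₂(q) = (q − 2 + √(q² + 32q − 32))/(18(q − 1)). Suppose t ∈ (t₁(q), t₂(q)). Then: (a) for z = N₋(t,q), the orbit (R_{z,t,q}ⁿ(z))_{n≥0} converges to a neutral fixed point w_N of R_{z,t,q} (R_{z,t,q}(w_N) = w_N and R'_{z,t,q}(w_N) = 1); and (b) there exists δ > 0 such that for every z with N₋(t,q) − δ < z < N₋(t,q), the orbit (R_{z,t,q}ⁿ(z))_{n≥0} converges to a fixed point w_A(z) of R_{z,t,q} with 0 < R'_{z,t,q}(w_A(z)) < 1 (an attracting fixed point). -/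

import Mathlib

noncomputable section

/-- The renormalization map `R_{z,t,q}(w) = z·((t + w + (q−2)tw)/(1 + (q−1)tw))²`,
viewed as a function of the real variable `w`. -/
def Rmap (z t q : ℝ) (w : ℝ) : ℝ :=
  z * ((t + w + (q - 2) * t * w) / (1 + (q - 1) * t * w)) ^ 2

/-- `t₂(q) = (q − 2 + √(q² + 32q − 32))/(18(q − 1))`. -/
def tTwo (q : ℝ) : ℝ := (q - 2 + Real.sqrt (q ^ 2 + 32 * q - 32)) / (18 * (q - 1))

/-- `N₊(t,q)`. -/
def Nplus (q t : ℝ) : ℝ :=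
  ((-27 * (q - 1) ^ 2 * t ^ 4 + 18 * (q ^ 2 - 3 * q + 2) * t ^ 3
      + (q ^ 2 + 14 * q - 14) * t ^ 2 + 2 * (q - 2) * t + 1)
    + Real.sqrt ((t - 1) * ((q - 1) * t + 1) * (9 * (q - 1) * t ^ 2 - (q - 2) * t - 1) ^ 3))
    / (8 * t * ((q - 2) * t + 1) ^ 3)

/-- `N₋(t,q)`. -/
def Nminus (q t : ℝ) : ℝ :=
  ((-27 * (q - 1) ^ 2 * t ^ 4 + 18 * (q ^ 2 - 3 * q + 2) * t ^ 3
      + (q ^ 2 + 14 * q - 14) * t ^ 2 + 2 * (q - 2) * t + 1)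
    - Real.sqrt ((t - 1) * ((q - 1) * t + 1) * (9 * (q - 1) * t ^ 2 - (q - 2) * t - 1) ^ 3))
    / (8 * t * ((q - 2) * t + 1) ^ 3)

/-- `t₁(q) = 1/(1+q)`. -/
def tOne (q : ℝ) : ℝ := 1 / (1 + q)

/-- The map `w ↦ z·((t + aw)/(1 + bw))²`, of which `Rmap z t q` is the case
`a = 1 + (q − 2)t`, `b = (q − 1)t`. -/
def mobiusSq (a b t z w : ℝ) : ℝ := z * ((t + a * w) / (1 + b * w)) ^ 2

lemma Rmap_eq_mobiusSq (z t q : ℝ) :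
    Rmap z t q = mobiusSq (1 + (q - 2) * t) ((q - 1) * t) t z := by
  funext w
  simp only [Rmap, mobiusSq]
  ring_nf

/-- An orbit of a monotone continuous self-map of `[c, ∞)` that starts by not increasing
converges to a fixed point. -/
lemma exists_fixedPoint_tendsto_iterate {f : ℝ → ℝ} {c x : ℝ}
    (hmono : MonotoneOn f (Set.Ici c)) (hcont : ContinuousOn f (Set.Ici c))
    (hc : c ≤ f c) (hx : c ≤ x) (hfx : f x ≤ x) :
    ∃ w, c ≤ w ∧ f w = w ∧ Filter.Tendsto (fun n : ℕ => f^[n] x) Filter.atTop (nhds w) := by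
  have hge : ∀ n, c ≤ f^[n] x := by
    intro n
    induction n with
    | zero => exact hx
    | succ n ih =>
      rw [Function.iterate_succ_apply']
      exact hc.trans (hmono Set.self_mem_Ici ih ih)
  have hanti : Antitone fun n : ℕ => f^[n] x := by
    refine antitone_nat_of_succ_le fun n => ?_
    induction n with
    | zero => exact hfx
    | succ n ih =>
      rw [Function.iterate_succ_apply' f (n + 1), Function.iterate_succ_apply' f n] at *
      exact hmono (hc.trans (hmono Set.self_mem_Ici (hge n) (hge n))) (hge n) ih
  have hlim := tendsto_atTop_ciInf hanti ⟨c, by rintro _ ⟨n, rfl⟩; exact hge n⟩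
  set w := ⨅ n : ℕ, f^[n] x
  have hw : c ≤ w := le_ciInf hge
  refine ⟨w, hw, ?_, hlim⟩
  have h1 : Filter.Tendsto (fun n : ℕ => f (f^[n] x)) Filter.atTop (nhds (f w)) :=
    (hcont w hw).tendsto.comp
      (tendsto_nhdsWithin_iff.2 ⟨hlim, Filter.Eventually.of_forall hge⟩)
  have h2 := hlim.comp (Filter.tendsto_add_atTop_nat 1)
  refine tendsto_nhds_unique h1 (h2.congr fun n => ?_)
  exact Function.iterate_succ_apply' f n x

section mobiusSq

variable {a b t z w : ℝ}

lemma monotoneOn_mobiusSq (ha : 0 < a) (hb : 0 < b) (ht : 0 < t) (hbt : b * t ≤ a)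
    (hz : 0 ≤ z) : MonotoneOn (mobiusSq a b t z) (Set.Ici 0) := by
  intro x hx y hy hxy
  simp only [Set.mem_Ici] at hx hy
  unfold mobiusSq
  have : (t + a * x) / (1 + b * x) ≤ (t + a * y) / (1 + b * y) := by
    rw [div_le_div_iff₀ (by positivity) (by positivity)]
    nlinarith [mul_nonneg (sub_nonneg.2 hxy) (sub_nonneg.2 hbt)]
  gcongr

lemma continuousOn_mobiusSq (hb : 0 < b) : ContinuousOn (mobiusSq a b t z) (Set.Ici 0) := by
  have h : ∀ x ∈ Set.Ici (0 : ℝ), 1 + b * x ≠ 0 := fun x hx => by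
    have := mul_nonneg hb.le hx
    positivity
  unfold mobiusSq
  fun_prop (disch := assumption)

lemma mobiusSq_le_iff (hb : 0 < b) (hw : 0 ≤ w) :
    mobiusSq a b t z w ≤ w ↔ z * (t + a * w) ^ 2 ≤ w * (1 + b * w) ^ 2 := by
  rw [mobiusSq, div_pow, ← mul_div_assoc, div_le_iff₀ (by positivity)]

lemma mobiusSq_eq_iff (hb : 0 < b) (hw : 0 ≤ w) :
    mobiusSq a b t z w = w ↔ z * (t + a * w) ^ 2 = w * (1 + b * w) ^ 2 := by
  rw [mobiusSq, div_pow, ← mul_div_assoc, div_eq_iff (by positivity)]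

lemma deriv_mobiusSq_of_fixed (ha : 0 < a) (hb : 0 < b) (ht : 0 < t) (hw : 0 ≤ w)
    (hfix : mobiusSq a b t z w = w) :
    deriv (mobiusSq a b t z) w = 2 * w * (a - b * t) / ((1 + b * w) * (t + a * w)) := by
  have hB : 1 + b * w ≠ 0 := by positivity
  have hT : t + a * w ≠ 0 := by positivity
  have hnum : HasDerivAt (fun x => t + a * x) a w := by
    simpa using ((hasDerivAt_id w).const_mul a).const_add t
  have hden : HasDerivAt (fun x => 1 + b * x) b w := by
    simpa using ((hasDerivAt_id w).const_mul b).const_add 1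
  have hd : HasDerivAt (mobiusSq a b t z) _ w := ((hnum.div hden hB).pow 2).const_mul z
  rw [hd.deriv]
  rw [mobiusSq_eq_iff hb hw] at hfix
  have hdet : a * (1 + b * w) - (t + a * w) * b = a - b * t := by ring
  simp only [Pi.div_apply, hdet, Nat.add_one_sub_one, pow_one, Nat.cast_ofNat]
  field_simp
  linear_combination (a - b * t) * hfix

/-- At the double root `v` the tangency value `N` is the value of
`w(1 + bw)²/(t + aw)²` at `v`, and this function is larger at every other `w ≥ t/(abv)`. -/
lemma tangency_le {v N : ℝ} (ha : 0 < a) (hb : 0 < b) (ht : 0 < t) (hbt : b * t < a) (hv : 0 < v)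
    (hvv : t < a * b * v ^ 2) (hP : a * b * v ^ 2 + (3 * b * t - a) * v + t = 0)
    (hN : N * (t + a * v) ^ 2 = v * (1 + b * v) ^ 2) (hw : t ≤ a * b * v * w) :
    N * (t + a * w) ^ 2 ≤ w * (1 + b * w) ^ 2 ∧
      (N * (t + a * w) ^ 2 = w * (1 + b * w) ^ 2 → w = v) := by
  have hid : v * (t + a * v) ^ 2 * (w * (1 + b * w) ^ 2 - N * (t + a * w) ^ 2) =
      (w - v) ^ 2 * (b ^ 2 * v * (t + a * v) ^ 2 * w - t ^ 2 * (1 + b * v) ^ 2) := by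
    linear_combination (w - v) * w * (t + a * v) * (1 + b * v) * hP - v * (t + a * w) ^ 2 * hN
  have hpos : 0 < b ^ 2 * v * (t + a * v) ^ 2 * w - t ^ 2 * (1 + b * v) ^ 2 := by
    have h1 := mul_le_mul_of_nonneg_left hw (by positivity : 0 ≤ b * (t + a * v) ^ 2)
    have h2 : 0 < t * ((a - b * t) * (a * b * v ^ 2 - t)) :=
      mul_pos ht (mul_pos (sub_pos.2 hbt) (sub_pos.2 hvv))
    refine pos_of_mul_pos_right (a := a) ?_ ha.le
    nlinarith
  have hc : 0 < v * (t + a * v) ^ 2 := by positivity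
  constructor
  · have := hid ▸ mul_nonneg (sq_nonneg (w - v)) hpos.le
    exact sub_nonneg.1 (nonneg_of_mul_nonneg_right this hc)
  · intro h
    rw [h, sub_self, mul_zero, eq_comm, mul_eq_zero, or_iff_left hpos.ne'] at hid
    exact sub_eq_zero.1 (pow_eq_zero_iff two_ne_zero |>.1 hid)

theorem mobiusSq_orbit_at_tangency {v N : ℝ} (ha : 0 < a) (hb : 0 < b) (ht : 0 < t)
    (hbt : b * t < a) (hv : 0 < v) (hvv : t < a * b * v ^ 2)
    (hP : a * b * v ^ 2 + (3 * b * t - a) * v + t = 0)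
    (hN : N * (t + a * v) ^ 2 = v * (1 + b * v) ^ 2) (hvN : v ≤ N) :
    mobiusSq a b t N v = v ∧ deriv (mobiusSq a b t N) v = 1 ∧
      Filter.Tendsto (fun n : ℕ => (mobiusSq a b t N)^[n] N) Filter.atTop (nhds v) := by
  have hfix : mobiusSq a b t N v = v := (mobiusSq_eq_iff hb hv.le).2 hN
  have hlarge : ∀ w, v ≤ w → t ≤ a * b * v * w := fun w hw => by
    have := mul_le_mul_of_nonneg_left hw (by positivity : 0 ≤ a * b * v)
    nlinarith
  have hsub : Set.Ici v ⊆ Set.Ici 0 := Set.Ici_subset_Ici.2 hv.le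
  refine ⟨hfix, ?_, ?_⟩
  · rw [deriv_mobiusSq_of_fixed ha hb ht hv.le hfix, div_eq_one_iff_eq (by positivity)]
    linear_combination -hP
  · obtain ⟨w, hvw, hw, hlim⟩ := exists_fixedPoint_tendsto_iterate
      ((monotoneOn_mobiusSq ha hb ht hbt.le (hv.le.trans hvN)).mono hsub)
      ((continuousOn_mobiusSq hb).mono hsub) hfix.ge hvN
      ((mobiusSq_le_iff hb (hv.le.trans hvN)).2
        (tangency_le ha hb ht hbt hv hvv hP hN (hlarge N hvN)).1)
    rw [mobiusSq_eq_iff hb (hv.le.trans hvw)] at hw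
    rwa [(tangency_le ha hb ht hbt hv hvv hP hN (hlarge w hvw)).2 hw] at hlim

theorem mobiusSq_orbit_below_tangency {v N : ℝ} (ha : 0 < a) (hb : 0 < b) (ht : 0 < t)
    (hbt : b * t < a) (hv : 0 < v) (hvv : t < a * b * v ^ 2)
    (hP : a * b * v ^ 2 + (3 * b * t - a) * v + t = 0)
    (hN : N * (t + a * v) ^ 2 = v * (1 + b * v) ^ 2) (hvz : t ≤ a * b * v * z) (hzN : z < N) :
    ∃ wA, mobiusSq a b t z wA = wA ∧ 0 < deriv (mobiusSq a b t z) wA ∧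
      deriv (mobiusSq a b t z) wA < 1 ∧
      Filter.Tendsto (fun n : ℕ => (mobiusSq a b t z)^[n] z) Filter.atTop (nhds wA) := by
  have hz : 0 < z := pos_of_mul_pos_right (ht.trans_le hvz) (by positivity)
  have hlt : ∀ w, 0 ≤ w → t ≤ a * b * v * w → z * (t + a * w) ^ 2 < w * (1 + b * w) ^ 2 :=
    fun w hw0 hw => (mul_lt_mul_of_pos_right hzN (by positivity)).trans_le
      (tangency_le ha hb ht hbt hv hvv hP hN hw).1
  have h0 : 0 ≤ mobiusSq a b t z 0 := by unfold mobiusSq; positivity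
  obtain ⟨w, hw0, hfix, hlim⟩ := exists_fixedPoint_tendsto_iterate
    (monotoneOn_mobiusSq ha hb ht hbt.le hz.le) (continuousOn_mobiusSq hb) h0 hz.le
    ((mobiusSq_le_iff hb hz.le).2 (hlt z hz.le hvz).le)
  have hfix' := (mobiusSq_eq_iff hb hw0).1 hfix
  have hwsmall : a * b * v * w < t := by
    by_contra! h
    exact (hlt w hw0 h).ne hfix'
  have hwpos : 0 < w := by
    rcases hw0.lt_or_eq with h | rfl
    · exact h
    · have : 0 < z * (t + a * 0) ^ 2 := by positivity
      rw [hfix', zero_mul] at this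
      exact this.false.elim
  have hwv : w < v := by
    refine lt_of_mul_lt_mul_left (a := a * b * v) ?_ (by positivity)
    nlinarith
  have hPw : 0 < a * b * w ^ 2 + (3 * b * t - a) * w + t := by
    refine pos_of_mul_pos_right (a := v) ?_ hv.le
    have : v * (a * b * w ^ 2 + (3 * b * t - a) * w + t) = (v - w) * (t - a * b * v * w) := by
      linear_combination w * hP
    rw [this]
    exact mul_pos (sub_pos.2 hwv) (sub_pos.2 hwsmall)
  refine ⟨w, hfix, ?_, ?_, hlim⟩ <;> rw [deriv_mobiusSq_of_fixed ha hb ht hw0 hfix]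
  · have := sub_pos.2 hbt
    positivity
  · rw [div_lt_one (by positivity)]
    linarith

end mobiusSq

lemma Nminus_eq {a b q t : ℝ} (ha : a = 1 + (q - 2) * t) (hb : b = (q - 1) * t)
    (hd : 0 ≤ a - 9 * b * t) :
    Nminus q t = (a ^ 2 + 18 * a * b * t - 27 * b ^ 2 * t ^ 2
      - (a - 9 * b * t) * √((a - b * t) * (a - 9 * b * t))) / (8 * t * a ^ 3) := by
  have hrad : (t - 1) * ((q - 1) * t + 1) * (9 * (q - 1) * t ^ 2 - (q - 2) * t - 1) ^ 3 =
      (a - 9 * b * t) ^ 2 * ((a - b * t) * (a - 9 * b * t)) := by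
    subst ha hb
    ring
  rw [Nminus, hrad, Real.sqrt_mul (sq_nonneg _), Real.sqrt_sq hd]
  subst ha hb
  ring

/-- `N₋` is the tangency value at the larger root `v` of the quadratic `abv² + (3bt − a)v + t`. -/
lemma exists_tangency_Nminus {a b q t : ℝ} (ha : a = 1 + (q - 2) * t) (hb : b = (q - 1) * t)
    (ha0 : 0 < a) (hb0 : 0 < b) (ht : 0 < t) (hd : 0 < a - 9 * b * t) :
    ∃ v, 0 < v ∧ t < a * b * v ^ 2 ∧ a * b * v ^ 2 + (3 * b * t - a) * v + t = 0 ∧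
      Nminus q t * (t + a * v) ^ 2 = v * (1 + b * v) ^ 2 := by
  have hbt : 0 < b * t := mul_pos hb0 ht
  have hrad : 0 < (a - b * t) * (a - 9 * b * t) := mul_pos (by linarith) hd
  have hs0 := Real.sqrt_pos.2 hrad
  have hs2 := Real.sq_sqrt hrad.le
  have hN := Nminus_eq ha hb hd.le
  set s := √((a - b * t) * (a - 9 * b * t))
  obtain ⟨v, hv⟩ : ∃ v, v = (a - 3 * b * t + s) / (2 * a * b) := ⟨_, rfl⟩
  have hsv : s = 2 * a * b * v - a + 3 * b * t := by
    rw [hv]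
    field_simp
    ring
  have hv0 : 0 < v := hv ▸ div_pos (by linarith) (by positivity)
  have hP : a * b * v ^ 2 + (3 * b * t - a) * v + t = 0 := by
    have h : 4 * a * b * (a * b * v ^ 2 + (3 * b * t - a) * v + t) = 0 := by
      rw [hsv] at hs2
      linear_combination hs2
    exact (mul_eq_zero.1 h).resolve_left (by positivity)
  refine ⟨v, hv0, ?_, hP, ?_⟩
  · nlinarith [mul_pos hs0 hv0]
  · rw [hN, hsv, div_mul_eq_mul_div, div_eq_iff (by positivity)]
    linear_combination ((2 * a ^ 2 + 6 * a * b * t) * t - (2 * a ^ 3 - 10 * a ^ 2 * b * t) * v) * hP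

/-- A parameter below `t₂(q)` makes the discriminant factor `a − 9bt` positive. -/
lemma discriminant_pos_of_lt_tTwo {q t : ℝ} (hq : 2 ≤ q) (ht : 0 < t) (ht2 : t < tTwo q) :
    0 < 1 + (q - 2) * t - 9 * ((q - 1) * t) * t := by
  rw [tTwo, lt_div_iff₀ (by linarith)] at ht2
  have hrad : 0 ≤ q ^ 2 + 32 * q - 32 := by nlinarith
  have hle : q - 2 ≤ √(q ^ 2 + 32 * q - 32) := Real.le_sqrt_of_sq_le (by nlinarith)
  have hpos : 0 < t * (q - 1) := mul_pos ht (by linarith)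
  have hsq : (t * (18 * (q - 1)) - (q - 2)) ^ 2 < √(q ^ 2 + 32 * q - 32) ^ 2 :=
    sq_lt_sq' (by linarith) (by linarith)
  rw [Real.sq_sqrt hrad] at hsq
  have h : 0 < 36 * (q - 1) * (1 + (q - 2) * t - 9 * ((q - 1) * t) * t) := by linarith
  exact pos_of_mul_pos_right h (by linarith)

/-- **Lemma (behaviour at and just below `z = N₋(t,q)` for `t₁(q) < t < t₂(q)`).**
Let `q ≥ 2` be a natural number and `t ∈ (t₁(q), t₂(q))`.  Then:
(a) for `z = N₋(t,q)`, the orbit of the marked point `z` under `R_{z,t,q}` converges to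
a neutral fixed point `w_N` (`R_{z,t,q}(w_N) = w_N`, `R'_{z,t,q}(w_N) = 1`); and
(b) there is `δ > 0` such that for every `z` with `N₋(t,q) − δ < z < N₋(t,q)`, the orbit
of `z` under `R_{z,t,q}` converges to an attracting fixed point `w_A(z)` of `R_{z,t,q}`
(`0 < R'_{z,t,q}(w_A(z)) < 1`). -/
theorem orbit_behaviour_near_Nminus
    (q : ℕ) (hq : 2 ≤ q) (t : ℝ) (ht1 : tOne q < t) (ht2 : t < tTwo q) :
    (∃ wN : ℝ, Rmap (Nminus q t) t q wN = wN ∧ deriv (Rmap (Nminus q t) t q) wN = 1 ∧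
      Filter.Tendsto (fun n : ℕ => (Rmap (Nminus q t) t q)^[n] (Nminus q t))
        Filter.atTop (nhds wN)) ∧
    (∃ δ : ℝ, 0 < δ ∧ ∀ z : ℝ, Nminus q t - δ < z → z < Nminus q t →
      ∃ wA : ℝ, Rmap z t q wA = wA ∧
        0 < deriv (Rmap z t q) wA ∧ deriv (Rmap z t q) wA < 1 ∧
        Filter.Tendsto (fun n : ℕ => (Rmap z t q)^[n] z) Filter.atTop (nhds wA)) := by
  have hq2 : (2 : ℝ) ≤ q := by exact_mod_cast hq
  have ht1' : 1 < t * (1 + q) := by rwa [tOne, div_lt_iff₀ (by linarith)] at ht1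
  have ht : 0 < t := pos_of_mul_pos_left (one_pos.trans ht1') (by linarith)
  have hd := discriminant_pos_of_lt_tTwo hq2 ht ht2
  have hq3 : (3 : ℝ) ≤ q := by
    rcases hq.lt_or_eq with h | rfl
    · exact_mod_cast h
    · norm_num at hd ht1'
      nlinarith
  obtain ⟨a, ha⟩ : ∃ a : ℝ, a = 1 + (q - 2) * t := ⟨_, rfl⟩
  obtain ⟨b, hb⟩ : ∃ b : ℝ, b = (q - 1) * t := ⟨_, rfl⟩
  have ha0 : 0 < a := by rw [ha]; nlinarith
  have hb0 : 0 < b := hb ▸ mul_pos (by linarith) ht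
  have hbt0 : 0 < b * t := mul_pos hb0 ht
  have hdab : 0 < a - 9 * b * t := by rwa [ha, hb]
  have hbt : b * t < a := by linarith
  obtain ⟨v, hv, hvv, hP, hN⟩ := exists_tangency_Nminus ha hb ha0 hb0 ht hdab
  have hab : t < a * b := by
    rw [ha, hb]
    nlinarith [mul_pos (mul_pos ht ht) (by nlinarith : 0 < ((q : ℝ) - 1) * (q - 2))]
  have hPone : 0 < a * b + (3 * b * t - a) + t := by
    have h : a * b + (3 * b * t - a) + t = (t * (1 + q) - 1) * ((q - 1) * t + 1) := by
      rw [ha, hb]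
      ring
    rw [h]
    exact mul_pos (by linarith) (by linarith)
  have hv1 : v < 1 := by
    by_contra! h
    have hpos : 0 < v * (a * b + (3 * b * t - a) + t) := mul_pos hv hPone
    have heq : v * (a * b + (3 * b * t - a) + t) = (1 - v) * (a * b * v - t) := by
      linear_combination hP
    have habv : t < a * b * v := hab.trans_le (le_mul_of_one_le_right (by positivity) h)
    rw [heq] at hpos
    exact hpos.not_ge (mul_nonpos_of_nonpos_of_nonneg (by linarith) (by linarith))
  have ht_lt : t < 1 := by
    by_contra! h
    have hle : a ≤ b := by
      rw [ha, hb]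
      linarith
    linarith [le_mul_of_one_le_right hb0.le h]
  have hvN : v < Nminus q t := by
    have h1 : t + a * v < 1 + b * v := by
      have hsub : 1 + b * v - (t + a * v) = (1 - t) * (1 - v) := by
        rw [ha, hb]
        ring
      exact sub_pos.1 (hsub ▸ mul_pos (sub_pos.2 ht_lt) (sub_pos.2 hv1))
    have h2 : v * (t + a * v) ^ 2 < Nminus q t * (t + a * v) ^ 2 := by
      rw [hN]
      gcongr
    exact lt_of_mul_lt_mul_right h2 (by positivity)
  simp only [Rmap_eq_mobiusSq, ← ha, ← hb]
  refine ⟨⟨v, mobiusSq_orbit_at_tangency ha0 hb0 ht hbt hv hvv hP hN hvN.le⟩,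
    Nminus q t - v, sub_pos.2 hvN, fun z hz hzN => ?_⟩
  refine mobiusSq_orbit_below_tangency ha0 hb0 ht hbt hv hvv hP hN ?_ hzN
  have hvz : v ≤ z := by linarith
  calc t ≤ a * b * v * v := by linarith [hvv, sq v, mul_assoc (a * b) v v]
    _ ≤ a * b * v * z := by gcongr
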